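/- Let B : EuclideanSpace ℝ (Fin q) → ((EuclideanSpace ℝ (Fin k)) →ₗ[ℝ] (EuclideanSpace ℝ (Fin q))) be continuous, with associated affine planes P_y and linear maps A y. Then the following are equivalent: (a) the planes P_y, y ∈ ℝ^q, are pairwise skew and their union is all of (EuclideanSpace ℝ (Fin k)) × (EuclideanSpace ℝ (Fin q)); (b) for all distinct x, y ∈ ℝ^q the kernel of A x − A y is trivial, and for every sequence (y_j) in ℝ^q with ‖y_j‖ → ∞ the distances Metric.infDist 0 (P_{y_j}) tend to ∞. -/

import Mathlib

open Metric Module Filter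

/-- The affine `k`-plane `P_y = {(t, B y t + y) : t}` associated to a map
`B` into the space of linear maps. -/
noncomputable def plane {q k : ℕ}
    (B : EuclideanSpace ℝ (Fin q) → (EuclideanSpace ℝ (Fin k) →ₗ[ℝ] EuclideanSpace ℝ (Fin q)))
    (y : EuclideanSpace ℝ (Fin q)) :
    AffineSubspace ℝ (EuclideanSpace ℝ (Fin k) × EuclideanSpace ℝ (Fin q)) :=
  AffineSubspace.mk' (0, y) (LinearMap.graph (B y))

open Polynomial in
theorem exists_polynomial_det_one_add_smul {E : Type*} [AddCommGroup E] [Module ℝ E]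
    [FiniteDimensional ℝ E] (M : E →ₗ[ℝ] E) :
    ∃ p : ℝ[X], p.natDegree ≤ finrank ℝ E ∧ ∀ t : ℝ, p.eval t = LinearMap.det (1 + t • M) := by
  let b := finBasis ℝ E
  let A := LinearMap.toMatrix b b M
  refine ⟨((X : ℝ[X]) • A.map C + (1 : Matrix _ _ ℝ).map C).det, ?_, fun t => ?_⟩
  · simpa using natDegree_det_X_add_C_le A 1
  · rw [← LinearMap.det_toMatrix b, ← Polynomial.coe_evalRingHom, RingHom.map_det]
    congr 1
    ext i j
    by_cases h : i = j <;>
      simp [A, LinearMap.toMatrix_one, h, add_comm] <;>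
      exact mul_comm _ _

theorem exists_finset_det_one_add_eq_sum {E : Type*} [AddCommGroup E] [Module ℝ E]
    [FiniteDimensional ℝ E] {ε : ℝ} (hε : 0 < ε) :
    ∃ (s : Finset ℝ) (w : ℝ → ℝ), (∀ t ∈ s, 0 < t ∧ t < ε) ∧ ∀ M : E →ₗ[ℝ] E,
      LinearMap.det (1 + M) = ∑ t ∈ s, w t * LinearMap.det (1 + t • M) := by
  obtain ⟨s, hs, hcard⟩ := (Set.Ioo_infinite hε).exists_subset_card_eq (finrank ℝ E + 1)
  refine ⟨s, fun t => (Lagrange.basis s id t).eval 1, fun t ht => hs ht, fun M => ?_⟩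
  obtain ⟨p, hp, hpe⟩ := exists_polynomial_det_one_add_smul M
  have hdeg : p.degree < s.card := by
    rw [hcard]
    exact (Polynomial.degree_le_of_natDegree_le hp).trans_lt (by exact_mod_cast Nat.lt_succ_self _)
  have h := congrArg (Polynomial.eval 1)
    (Lagrange.eq_interpolate (v := id) Function.injective_id.injOn hdeg)
  rw [hpe, one_smul, Lagrange.interpolate_apply, Polynomial.eval_finsetSum] at h
  rw [h]
  exact Finset.sum_congr rfl fun t _ => by simp [hpe, mul_comm]

/-- A sphere in a finite-dimensional inner product space is not a `C¹` retract. -/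
theorem exists_ne_of_contDiff_of_norm_eq {E : Type*} [NormedAddCommGroup E]
    [InnerProductSpace ℝ E] [FiniteDimensional ℝ E] {r : E → E} (hr : ContDiff ℝ 1 r) {R : ℝ}
    (hR : 0 < R) (hnorm : ∀ y, ‖r y‖ = R) : ∃ y, ‖y‖ = R ∧ r y ≠ y := by
  by_contra! hfix
  borelize E
  let μ : MeasureTheory.Measure E := MeasureTheory.volume
  let F : ℝ → E → E := fun t y => y + t • (r y - y)
  let D : E → E →L[ℝ] E := fun y => fderiv ℝ r y - 1
  have hDc : Continuous D := (hr.continuous_fderiv one_ne_zero).sub continuous_const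
  have hFd (t : ℝ) (y : E) : HasStrictFDerivAt (F t) (1 + t • D y) y :=
    (hasStrictFDerivAt_id y).add
      (((hr.contDiffAt.hasStrictFDerivAt one_ne_zero).sub (hasStrictFDerivAt_id y)).const_smul t)
  have hFc (t : ℝ) : Continuous (F t) := by have := hr.continuous; fun_prop
  have hdetc (t : ℝ) : Continuous fun y => (1 + t • D y).det :=
    ContinuousLinearMap.continuous_det.comp (continuous_const.add (hDc.const_smul t))
  -- injectivity for small parameters
  obtain ⟨C, hC⟩ : ∃ C, LipschitzOnWith C (fun y => r y - y) (closedBall 0 R) :=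
    (hr.sub contDiff_id).contDiffOn.exists_lipschitzOnWith one_ne_zero (convex_closedBall 0 R)
      (isCompact_closedBall 0 R)
  have hinj (t : ℝ) (ht0 : 0 < t) (ht : t * C < 1) : Set.InjOn (F t) (closedBall 0 R) := by
    intro x hx y hy hxy
    have h1 : x - y = t • ((r y - y) - (r x - x)) := by
      have : x + t • (r x - x) = y + t • (r y - y) := hxy
      rw [smul_sub, sub_eq_sub_iff_add_eq_add, this, add_comm]
    have h2 : ‖(r y - y) - (r x - x)‖ ≤ C * ‖x - y‖ := by
      simpa [dist_eq_norm, norm_sub_rev] using hC.dist_le_mul y hy x hx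
    have h3 : ‖x - y‖ ≤ t * (C * ‖x - y‖) := by
      conv_lhs => rw [h1, norm_smul, Real.norm_of_nonneg ht0.le]
      gcongr
    have h4 : ‖x - y‖ ≤ 0 := by
      by_contra! h
      nlinarith
    exact sub_eq_zero.1 (norm_le_zero_iff.1 h4)
  -- positivity of the Jacobian for small parameters
  have hdetpos : ∀ᶠ t : ℝ in nhds 0, ∀ y ∈ closedBall (0 : E) R, 0 < (1 + t • D y).det := by
    refine (isCompact_closedBall 0 R).eventually_forall_of_forall_eventually fun y _ => ?_
    have hc : Continuous fun z : ℝ × E => (1 + z.1 • D z.2).det :=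
      ContinuousLinearMap.continuous_det.comp
        (continuous_const.add (continuous_fst.smul (hDc.comp continuous_snd)))
    refine hc.continuousAt.eventually (lt_mem_nhds ?_)
    simp [ContinuousLinearMap.det]
  obtain ⟨ε, hε, hdetε⟩ := Metric.eventually_nhds_iff.1 hdetpos
  have himage (t : ℝ) (ht0 : 0 < t) (ht1 : t < 1)
      (hdet : ∀ y ∈ closedBall (0 : E) R, 0 < (1 + t • D y).det) :
      F t '' ball 0 R = ball 0 R := by
    have hsub : F t '' ball 0 R ⊆ ball 0 R := by
      rintro _ ⟨y, hy, rfl⟩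
      have hy' : ‖y‖ < R := by simpa using hy
      have h1 : F t y = (1 - t) • y + t • r y := by simp only [F]; module
      rw [mem_ball_zero_iff, h1]
      calc ‖(1 - t) • y + t • r y‖ ≤ (1 - t) * ‖y‖ + t * R := by
            refine (norm_add_le _ _).trans_eq ?_
            rw [norm_smul, norm_smul, hnorm, Real.norm_of_nonneg ht0.le,
              Real.norm_of_nonneg (by linarith)]
        _ < R := by nlinarith
    refine hsub.antisymm ?_
    have hopen : IsOpen (F t '' ball 0 R) := by
      rw [isOpen_iff_mem_nhds]
      rintro _ ⟨y, hy, rfl⟩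
      rw [← (hFd t y).map_nhds_eq_of_surj]
      · exact image_mem_map (isOpen_ball.mem_nhds hy)
      · exact LinearMap.range_eq_top.2 ((Module.End.isUnit_iff _).1
          ((LinearMap.isUnit_iff_isUnit_det _).2
            (hdet y (ball_subset_closedBall hy)).ne'.isUnit)).2
    have hne : (F t '' ball 0 R).Nonempty := ⟨_, 0, by simpa using hR, rfl⟩
    refine (convex_ball (0 : E) R).isPreconnected.subset_of_closure_inter_subset hopen
      (by rwa [Set.inter_eq_right.2 hsub]) ?_
    rintro z ⟨hz, hzR⟩
    have hcl : closure (F t '' ball 0 R) ⊆ F t '' closedBall 0 R :=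
      closure_minimal (Set.image_mono ball_subset_closedBall)
        ((isCompact_closedBall 0 R).image (hFc t)).isClosed
    obtain ⟨y, hy, rfl⟩ := hcl hz
    refine ⟨y, ?_, rfl⟩
    rcases (mem_closedBall_zero_iff.1 hy).lt_or_eq with h | h
    · simpa using h
    · have : F t y = y := by simp [F, hfix y h]
      rwa [this] at hzR
  have hint (t : ℝ) : MeasureTheory.IntegrableOn (fun y => (1 + t • D y).det) (ball 0 R) μ :=
    ((hdetc t).continuousOn.integrableOn_compact (isCompact_closedBall 0 R)).mono_set
      ball_subset_closedBall
  have hvol (t : ℝ) (ht0 : 0 < t) (ht1 : t < 1) (htC : t * C < 1) (htε : t < ε) :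
      ∫ y in ball 0 R, (1 + t • D y).det ∂μ = μ.real (ball 0 R) := by
    have hdet : ∀ y ∈ closedBall (0 : E) R, 0 < (1 + t • D y).det :=
      hdetε (by simpa [abs_of_pos ht0] using htε)
    have h := MeasureTheory.integral_image_eq_integral_abs_det_fderiv_smul μ
      measurableSet_ball (fun y _ => (hFd t y).hasFDerivAt.hasFDerivWithinAt)
      ((hinj t ht0 htC).mono ball_subset_closedBall) (fun _ => (1 : ℝ))
    rw [himage t ht0 ht1 hdet] at h
    simp only [MeasureTheory.setIntegral_const, smul_eq_mul, mul_one] at h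
    rw [h]
    exact MeasureTheory.setIntegral_congr_fun measurableSet_ball fun y hy =>
      (abs_of_pos (hdet y (ball_subset_closedBall hy))).symm
  have hsing (y : E) : (1 + D y).det = 0 := by
    by_contra h
    have hsurj := ((Module.End.isUnit_iff _).1
      ((LinearMap.isUnit_iff_isUnit_det _).2 (Ne.isUnit h))).2
    obtain ⟨v, hv⟩ := hsurj (r y)
    have hv' : fderiv ℝ r y v = r y := by simpa [D] using hv
    have hd := ((hr.differentiable one_ne_zero) y).hasFDerivAt
    have h1 := (hd.inner ℝ hd)
    have h2 : (fun y => inner ℝ (r y) (r y)) = fun _ => R * R := by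
      ext y; rw [real_inner_self_eq_norm_mul_norm, hnorm]
    rw [h2] at h1
    have h3 := congrArg (fun L => L v) (h1.unique (hasFDerivAt_const _ _))
    simp [hv', hnorm, hR.ne'] at h3
  obtain ⟨s, w, hs, hw⟩ := exists_finset_det_one_add_eq_sum (E := E)
    (ε := min (min 1 ε) (1 / (C + 1))) (by positivity)
  have hsum : ∑ t ∈ s, w t = 1 := by simpa using (hw 0).symm
  have hzero : (0 : ℝ) = μ.real (ball 0 R) := by
    calc (0 : ℝ) = ∫ y in ball 0 R, (1 + D y).det ∂μ := by simp [hsing]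
      _ = ∫ y in ball 0 R, ∑ t ∈ s, w t * (1 + t • D y).det ∂μ := by
          congr 1; ext y; exact hw (D y : E →ₗ[ℝ] E)
      _ = ∑ t ∈ s, w t * ∫ y in ball 0 R, (1 + t • D y).det ∂μ := by
          rw [MeasureTheory.integral_finsetSum _ fun t _ => (hint t).const_mul _]
          simp_rw [MeasureTheory.integral_const_mul]
      _ = ∑ t ∈ s, w t * μ.real (ball 0 R) := by
          refine Finset.sum_congr rfl fun t ht => ?_
          obtain ⟨h0, h1⟩ := hs t ht
          simp only [lt_min_iff] at h1
          rw [hvol t h0 h1.1.1 ?_ h1.1.2]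
          have := (lt_div_iff₀ (by positivity)).1 h1.2
          nlinarith
      _ = μ.real (ball 0 R) := by rw [← Finset.sum_mul, hsum, one_mul]
  exact (ENNReal.toReal_pos (measure_ball_pos μ 0 hR).ne'
    MeasureTheory.measure_ball_lt_top.ne).ne hzero

open scoped Manifold in
/-- A continuous self-map of a finite-dimensional inner product space that is the identity outside
a ball has a zero. -/
theorem exists_eq_zero_of_eq_self_of_le_norm {E : Type*} [NormedAddCommGroup E]
    [InnerProductSpace ℝ E] [FiniteDimensional ℝ E] {φ : E → E} (hφ : Continuous φ) {R : ℝ}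
    (hR : 0 < R) (hid : ∀ y, R ≤ ‖y‖ → φ y = y) : ∃ y, φ y = 0 := by
  by_contra! hne
  obtain ⟨m, hm, hmφ⟩ := (isCompact_closedBall (0 : E) R).exists_forall_le' hφ.norm.continuousOn
    (a := 0) fun y _ => norm_pos_iff.2 (hne y)
  obtain ⟨δ, hδ, hδφ⟩ : ∃ δ > 0, ∀ y, δ ≤ ‖φ y‖ := by
    refine ⟨min m R, lt_min hm hR, fun y => ?_⟩
    rcases le_total ‖y‖ R with h | h
    · exact (min_le_left _ _).trans (hmφ y (mem_closedBall_zero_iff.2 h))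
    · rw [hid y h]
      exact (min_le_right _ _).trans h
  obtain ⟨g, hg⟩ := exists_contMDiffMap_forall_mem_convex_of_local_const (n := 1) 𝓘(ℝ, E)
    (t := fun y => if ‖y‖ < 2 * R then ball (y - φ y) δ else {0})
    (fun y => by
      split_ifs
      exacts [convex_ball _ _, convex_singleton _])
    (fun x => by
      rcases lt_or_ge R ‖x‖ with hx | hx
      · refine ⟨0, ?_⟩
        filter_upwards [continuous_norm.continuousAt.eventually (lt_mem_nhds hx)] with y hy
        split_ifs
        · simpa [hid y hy.le] using hδ
        · rfl
      · refine ⟨x - φ x, ?_⟩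
        have h2 : ‖x‖ < 2 * R := by linarith
        have hc : Continuous fun y => y - φ y := continuous_id.sub hφ
        filter_upwards [continuous_norm.continuousAt.eventually (gt_mem_nhds h2),
          hc.continuousAt.eventually (ball_mem_nhds _ hδ)] with y hy hy'
        rw [if_pos hy]
        exact mem_ball_comm.1 hy')
  have hgs : ContDiff ℝ 1 g := g.contMDiff.contDiff
  have hgne (y : E) : y - g y ≠ 0 := by
    intro h
    have hy := hg y
    rw [← sub_eq_zero.1 h] at hy
    split_ifs at hy with hlt
    · rw [mem_ball, dist_eq_norm] at hy
      simp only [sub_sub_cancel] at hy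
      exact (hδφ y).not_gt hy
    · rw [Set.mem_singleton_iff.1 hy, norm_zero] at hlt
      exact hlt (by positivity)
  have hψ : ContDiff ℝ 1 fun y => y - g y := contDiff_id.sub hgs
  obtain ⟨y, hy, hyne⟩ := exists_ne_of_contDiff_of_norm_eq
    (r := fun y => (2 * R / ‖y - g y‖) • (y - g y)) (R := 2 * R)
    ((contDiff_const.div (hψ.norm ℝ hgne) fun y => norm_ne_zero_iff.2 (hgne y)).smul hψ)
    (by positivity) (fun y => by
      have := norm_ne_zero_iff.2 (hgne y)
      rw [norm_smul, Real.norm_of_nonneg (by positivity)]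
      field_simp)
  have hgy := hg y
  rw [if_neg hy.not_lt, Set.mem_singleton_iff] at hgy
  apply hyne
  simp [hgy, hy, (by positivity : 2 * R ≠ 0)]

/-- Leray–Schauder continuation from a translation. -/
theorem exists_eq_zero_of_homotopy {E : Type*} [NormedAddCommGroup E]
    [InnerProductSpace ℝ E] [FiniteDimensional ℝ E] {H : ℝ → E → E}
    (hH : Continuous (Function.uncurry H)) {c : E} (h0 : ∀ y, H 0 y = y - c) {R : ℝ} (hR : 0 < R)
    (hsphere : ∀ s ∈ Set.Icc (0 : ℝ) 1, ∀ y, ‖y - c‖ = R → H s y ≠ 0) :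
    ∃ y, ‖y - c‖ < R ∧ H 1 y = 0 := by
  have hH' : Continuous fun p : ℝ × E => H p.1 (p.2 + c) :=
    hH.comp (continuous_fst.prodMk (continuous_snd.add continuous_const))
  let K : Set E := Prod.snd '' ((Set.Icc (0 : ℝ) 1 ×ˢ closedBall (0 : E) R) ∩
    {p : ℝ × E | H p.1 (p.2 + c) = 0})
  have hK : IsClosed K :=
    (((isCompact_Icc.prod (isCompact_closedBall 0 R)).inter_right
      (isClosed_eq hH' continuous_const)).image continuous_snd).isClosed
  have hKlt : ∀ y ∈ K, ‖y‖ < R := by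
    rintro _ ⟨⟨s, y⟩, ⟨⟨hs, hy⟩, hz⟩, rfl⟩
    refine (mem_closedBall_zero_iff.1 hy).lt_of_ne fun h => hsphere s hs (y + c) (by simpa) hz
  obtain ⟨f, hf0, hf1, hf⟩ := exists_continuous_zero_one_of_isClosed
    (isClosed_le continuous_const continuous_norm : IsClosed {y : E | R ≤ ‖y‖}) hK
    (Set.disjoint_left.2 fun y hy hyK => (hKlt y hyK).not_ge hy)
  obtain ⟨y, hy⟩ := exists_eq_zero_of_eq_self_of_le_norm (φ := fun y => H (f y) (y + c))
    (hH'.comp (f.continuous.prodMk continuous_id)) hR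
    (fun y hy => by simp [hf0 hy, h0])
  have hyK : y ∈ K := by
    refine ⟨(f y, y), ⟨⟨hf y, ?_⟩, hy⟩, rfl⟩
    by_contra! h
    have hlt : R < ‖y‖ := by simpa using h
    have hy0 : y = 0 := by simpa [hf0 (show R ≤ ‖y‖ from hlt.le), h0] using hy
    rw [hy0, norm_zero] at hlt
    exact hlt.not_gt hR
  refine ⟨y + c, by simpa using hKlt y hyK, ?_⟩
  simpa [hf1 hyK] using hy

theorem mem_plane_iff {q k : ℕ}
    {B : EuclideanSpace ℝ (Fin q) → (EuclideanSpace ℝ (Fin k) →ₗ[ℝ] EuclideanSpace ℝ (Fin q))}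
    {y : EuclideanSpace ℝ (Fin q)} {p : EuclideanSpace ℝ (Fin k) × EuclideanSpace ℝ (Fin q)} :
    p ∈ plane B y ↔ p.2 = B y p.1 + y := by
  simp [plane, AffineSubspace.mem_mk', LinearMap.mem_graph_iff, sub_eq_iff_eq_add]

theorem continuous_apply_add {q k : ℕ}
    {B : EuclideanSpace ℝ (Fin q) → (EuclideanSpace ℝ (Fin k) →ₗ[ℝ] EuclideanSpace ℝ (Fin q))}
    (hB : Continuous fun y => LinearMap.toContinuousLinearMap (B y)) :
    Continuous fun p : EuclideanSpace ℝ (Fin k) × EuclideanSpace ℝ (Fin q) => B p.2 p.1 + p.2 :=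
  ((hB.comp continuous_snd).clm_apply continuous_fst).add continuous_snd

theorem eventually_norm_le_of_mem_plane {q k : ℕ}
    {B : EuclideanSpace ℝ (Fin q) → (EuclideanSpace ℝ (Fin k) →ₗ[ℝ] EuclideanSpace ℝ (Fin q))}
    (hB : Continuous fun y => LinearMap.toContinuousLinearMap (B y))
    (hinj : ∀ t x y, B x t + x = B y t + y → x = y)
    {p₀ : EuclideanSpace ℝ (Fin k) × EuclideanSpace ℝ (Fin q)} {y₀ : EuclideanSpace ℝ (Fin q)}
    (hp₀ : p₀ ∈ plane B y₀) :
    ∀ᶠ p in nhds p₀, ∀ y, p ∈ plane B y → ‖y‖ ≤ ‖y₀‖ + 1 := by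
  have hf := continuous_apply_add hB
  have hf₀ : Continuous fun t => B y₀ t + y₀ := hf.comp (continuous_id.prodMk continuous_const)
  have hN : Continuous fun p : EuclideanSpace ℝ (Fin k) × EuclideanSpace ℝ (Fin q) =>
      ‖B p.2 p.1 + p.2 - (B y₀ p.1 + y₀)‖ :=
    (hf.sub (hf₀.comp continuous_fst)).norm
  have hpos : ∀ p ∈ closedBall (0 : EuclideanSpace ℝ (Fin k)) (‖p₀.1‖ + 1) ×ˢ sphere y₀ 1,
      0 < ‖B p.2 p.1 + p.2 - (B y₀ p.1 + y₀)‖ := by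
    rintro ⟨t, y⟩ ⟨-, hy⟩
    rw [norm_pos_iff, sub_ne_zero]
    intro h
    rw [hinj t y y₀ h] at hy
    simp at hy
  obtain ⟨m, hm, hmle⟩ :=
    ((isCompact_closedBall _ _).prod (isCompact_sphere y₀ 1)).exists_forall_le'
      hN.continuousOn hpos
  have h1 : ∀ᶠ p in nhds p₀, ‖p.1‖ < ‖p₀.1‖ + 1 :=
    continuous_fst.norm.continuousAt.eventually (gt_mem_nhds (lt_add_one _))
  have h2 : ∀ᶠ p in nhds p₀, ‖p.2 - (B y₀ p.1 + y₀)‖ < m := by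
    refine (continuous_snd.sub (hf₀.comp continuous_fst)).norm.continuousAt.eventually
      (gt_mem_nhds ?_)
    simpa [mem_plane_iff.1 hp₀] using hm
  filter_upwards [h1, h2] with p hp1 hp2 y hy
  obtain ⟨x, hx, hxz⟩ := exists_eq_zero_of_homotopy (c := y₀) (R := 1)
    (H := fun s x => B x (s • p.1) + x - (B y₀ (s • p.1) + y₀) - s • (p.2 - (B y₀ p.1 + y₀)))
    (by
      have hst : Continuous fun a : ℝ × EuclideanSpace ℝ (Fin q) => a.1 • p.1 :=
        continuous_fst.smul continuous_const
      exact ((hf.comp (hst.prodMk continuous_snd)).sub (hf₀.comp hst)).sub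
        (continuous_fst.smul continuous_const))
    (fun x => by simp) one_pos
    (fun s hs x hx h => by
      have hst : ‖s • p.1‖ ≤ ‖p₀.1‖ + 1 := by
        rw [norm_smul, Real.norm_of_nonneg hs.1]
        nlinarith [norm_nonneg p.1, hs.2]
      have hle := hmle (s • p.1, x) ⟨by simpa using hst, by simpa [dist_eq_norm] using hx⟩
      dsimp only at hle
      rw [sub_eq_zero.1 h, norm_smul, Real.norm_of_nonneg hs.1] at hle
      nlinarith [norm_nonneg (p.2 - (B y₀ p.1 + y₀)), hs.2])
  have hxy : x = y := by
    refine hinj p.1 x y ?_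
    rw [← mem_plane_iff.1 hy, ← sub_eq_zero, ← hxz]
    simp
  subst hxy
  linarith [norm_sub_norm_le x y₀]

theorem tendsto_infDist_plane {q k : ℕ}
    {B : EuclideanSpace ℝ (Fin q) → (EuclideanSpace ℝ (Fin k) →ₗ[ℝ] EuclideanSpace ℝ (Fin q))}
    (hB : Continuous fun y => LinearMap.toContinuousLinearMap (B y))
    (hinj : ∀ t x y, B x t + x = B y t + y → x = y)
    (hsurj : ∀ p : EuclideanSpace ℝ (Fin k) × EuclideanSpace ℝ (Fin q), ∃ y, p ∈ plane B y)
    {yseq : ℕ → EuclideanSpace ℝ (Fin q)} (hy : Tendsto (fun j => ‖yseq j‖) atTop atTop) :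
    Tendsto (fun j => infDist 0
      (plane B (yseq j) : Set (EuclideanSpace ℝ (Fin k) × EuclideanSpace ℝ (Fin q))))
      atTop atTop := by
  rw [Filter.tendsto_atTop]
  intro M
  obtain ⟨R, hR⟩ : ∃ R, ∀ p ∈ closedBall (0 : EuclideanSpace ℝ (Fin k) × _) M,
      ∀ y, p ∈ plane B y → ‖y‖ ≤ R := by
    refine (isCompact_closedBall _ M).induction_on ⟨0, by simp⟩ ?_ ?_ ?_
    · rintro s t hst ⟨R, hR⟩
      exact ⟨R, fun p hp => hR p (hst hp)⟩
    · rintro s t ⟨R, hR⟩ ⟨R', hR'⟩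
      refine ⟨max R R', fun p hp y hpy => ?_⟩
      rcases hp with hp | hp
      · exact (hR p hp y hpy).trans (le_max_left _ _)
      · exact (hR' p hp y hpy).trans (le_max_right _ _)
    · intro p _
      obtain ⟨y₀, hy₀⟩ := hsurj p
      exact ⟨_, mem_nhdsWithin_of_mem_nhds (eventually_norm_le_of_mem_plane hB hinj hy₀),
        ‖y₀‖ + 1, fun _ h => h⟩
  filter_upwards [hy.eventually_gt_atTop R] with j hj
  by_contra! h
  obtain ⟨p, hp, hdist⟩ := (infDist_lt_iff ⟨(0, yseq j), mem_plane_iff.2 (by simp)⟩).1 h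
  exact hj.not_ge (hR p (by simpa [dist_comm] using hdist.le) _ hp)

theorem exists_mem_plane_of_tendsto_infDist {q k : ℕ}
    {B : EuclideanSpace ℝ (Fin q) → (EuclideanSpace ℝ (Fin k) →ₗ[ℝ] EuclideanSpace ℝ (Fin q))}
    (hB : Continuous fun y => LinearMap.toContinuousLinearMap (B y))
    (hprop : ∀ yseq : ℕ → EuclideanSpace ℝ (Fin q), Tendsto (fun j => ‖yseq j‖) atTop atTop →
      Tendsto (fun j => infDist 0
        (plane B (yseq j) : Set (EuclideanSpace ℝ (Fin k) × EuclideanSpace ℝ (Fin q))))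
        atTop atTop)
    (p : EuclideanSpace ℝ (Fin k) × EuclideanSpace ℝ (Fin q)) : ∃ y, p ∈ plane B y := by
  obtain ⟨n, hn⟩ : ∃ n : ℕ, ∀ y, (n : ℝ) ≤ ‖y‖ → ‖p‖ < infDist 0
      (plane B y : Set (EuclideanSpace ℝ (Fin k) × EuclideanSpace ℝ (Fin q))) := by
    by_contra! h
    choose y hy hyp using h
    obtain ⟨j, hj⟩ := ((hprop y (tendsto_atTop_mono hy
      tendsto_natCast_atTop_atTop)).eventually_gt_atTop ‖p‖).exists
    exact hj.not_ge (hyp j)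
  obtain ⟨y, -, hy⟩ := exists_eq_zero_of_homotopy (c := p.2) (R := n + ‖p.2‖ + 1)
    (H := fun s y => B y (s • p.1) + y - p.2)
    (((continuous_apply_add hB).comp
      ((continuous_fst.smul continuous_const).prodMk continuous_snd)).sub continuous_const)
    (fun y => by simp) (by positivity)
    (fun s hs y hy h => by
      have hny : (n : ℝ) ≤ ‖y‖ := by linarith [norm_sub_le y p.2]
      have hmem : (s • p.1, p.2) ∈ plane B y := mem_plane_iff.2 (sub_eq_zero.1 h).symm
      have hle : ‖(s • p.1, p.2)‖ ≤ ‖p‖ := by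
        rw [Prod.norm_def, Prod.norm_def, norm_smul, Real.norm_of_nonneg hs.1]
        exact max_le_max_right _ (mul_le_of_le_one_left (norm_nonneg _) hs.2)
      have hd := infDist_le_dist_of_mem (x := 0) hmem
      rw [dist_zero_left] at hd
      exact (hn y hny).not_ge (hd.trans hle))
  exact ⟨y, mem_plane_iff.2 (by simpa using (sub_eq_zero.1 hy).symm)⟩

theorem skew_fibration_iff_kernel_and_proper (q k : ℕ)
    (B : EuclideanSpace ℝ (Fin q) → (EuclideanSpace ℝ (Fin k) →ₗ[ℝ] EuclideanSpace ℝ (Fin q)))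
    (hB : Continuous fun y => LinearMap.toContinuousLinearMap (B y)) :
    (((∀ x y : EuclideanSpace ℝ (Fin q), x ≠ y →
        Disjoint (plane B x : Set (EuclideanSpace ℝ (Fin k) × EuclideanSpace ℝ (Fin q)))
          (plane B y : Set (EuclideanSpace ℝ (Fin k) × EuclideanSpace ℝ (Fin q))) ∧
        (plane B x).direction ⊓ (plane B y).direction = ⊥) ∧
      (∀ p : EuclideanSpace ℝ (Fin k) × EuclideanSpace ℝ (Fin q),
        ∃ y : EuclideanSpace ℝ (Fin q), p ∈ plane B y)) ↔
    ((∀ x y : EuclideanSpace ℝ (Fin q), x ≠ y →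
        ∀ (t : EuclideanSpace ℝ (Fin k)) (lam : ℝ),
          (B x - B y) t + lam • (x - y) = 0 → t = 0 ∧ lam = 0) ∧
      (∀ yseq : ℕ → EuclideanSpace ℝ (Fin q),
        Tendsto (fun j => ‖yseq j‖) atTop atTop →
        Tendsto (fun j =>
          infDist 0 (plane B (yseq j) : Set (EuclideanSpace ℝ (Fin k) × EuclideanSpace ℝ (Fin q))))
          atTop atTop))) := by
  constructor
  · rintro ⟨hskew, hsurj⟩
    have hinj : ∀ t x y, B x t + x = B y t + y → x = y := by
      intro t x y h
      by_contra hxy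
      exact Set.disjoint_left.1 (hskew x y hxy).1
        (show (t, B x t + x) ∈ plane B x from mem_plane_iff.2 rfl) (mem_plane_iff.2 h)
    refine ⟨fun x y hxy t lam h => ?_, fun yseq hy => tendsto_infDist_plane hB hinj hsurj hy⟩
    rcases eq_or_ne lam 0 with rfl | hlam
    · refine ⟨?_, rfl⟩
      have hBt : B x t = B y t := by simpa [sub_eq_zero] using h
      have hmem : (t, B x t) ∈ (plane B x).direction ⊓ (plane B y).direction := by
        simp [plane, LinearMap.mem_graph_iff, hBt]
      rw [(hskew x y hxy).2, Submodule.mem_bot] at hmem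
      exact congrArg Prod.fst hmem
    · refine absurd (hinj (lam⁻¹ • t) x y ?_) hxy
      have h' := congrArg (lam⁻¹ • ·) h
      simp only [smul_add, smul_zero, inv_smul_smul₀ hlam, LinearMap.sub_apply, smul_sub] at h'
      rw [map_smul, map_smul, ← sub_eq_zero, ← h']
      abel
  · rintro ⟨hker, hprop⟩
    refine ⟨fun x y hxy => ⟨?_, ?_⟩, exists_mem_plane_of_tendsto_infDist hB hprop⟩
    · refine Set.disjoint_left.2 fun p hpx hpy => one_ne_zero (hker x y hxy p.1 1 ?_).2
      have h := (mem_plane_iff.1 hpx).symm.trans (mem_plane_iff.1 hpy)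
      rw [← sub_eq_zero] at h
      rw [← h, LinearMap.sub_apply, one_smul]
      abel
    · refine (Submodule.eq_bot_iff _).2 ?_
      rintro ⟨t, v⟩ ⟨hx, hy⟩
      simp only [plane, AffineSubspace.direction_mk', SetLike.mem_coe,
        LinearMap.mem_graph_iff] at hx hy
      have ht : t = 0 := (hker x y hxy t 0 (by simp [← hx, ← hy])).1
      simp [ht, hx]
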